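/- Let n ≥ 2 be an integer and r a real number with 0 ≤ r ≤ π/4. There exists a spherical code C in ℝ^n with maximal inner product cos(2r)/(1 + cos(2r)) such that |C| ≥ 2·B((n−1)/2, 1/2) / B((sec r)² − (sec r)⁴/4; (n−1)/2, 1/2). -/

import Mathlib

open scoped RealInnerProductSpace

/-- The incomplete beta function `B(x; y, z) = ∫_0^x t^(y-1) (1-t)^(z-1) dt`;
the (complete) beta function is `B(y, z) = incBeta 1 y z`. -/
noncomputable def incBeta (x y z : ℝ) : ℝ :=
  ∫ t in (0:ℝ)..x, t ^ (y - 1) * (1 - t) ^ (z - 1)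

/-- A spherical code in `ℝ^n` with maximal inner product `t`: a finite set of
unit vectors whose pairwise inner products are at most `t`. -/
def IsSphericalCode (n : ℕ) (t : ℝ) (C : Finset (EuclideanSpace ℝ (Fin n))) : Prop :=
  (∀ x ∈ C, ‖x‖ = 1) ∧ ∀ x ∈ C, ∀ y ∈ C, x ≠ y → ⟪x, y⟫ ≤ t

open MeasureTheory Set Metric
open scoped ENNReal NNReal

/-- Integration of a radial function in polar coordinates. -/
theorem lintegral_fun_norm_addHaar {F : Type*} [NormedAddCommGroup F] [NormedSpace ℝ F]
    [FiniteDimensional ℝ F] [Nontrivial F] [MeasurableSpace F] [BorelSpace F]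
    (μ : Measure F) [μ.IsAddHaarMeasure] {f : ℝ → ℝ≥0∞} (hf : Measurable f) :
    ∫⁻ x, f ‖x‖ ∂μ = μ.toSphere univ *
      ∫⁻ y in Ioi (0 : ℝ), ENNReal.ofReal (y ^ (Module.finrank ℝ F - 1)) * f y :=
  calc
    ∫⁻ x, f ‖x‖ ∂μ = ∫⁻ x : ({(0)}ᶜ : Set F), f ‖x.1‖ ∂(μ.comap (↑)) := by
      rw [lintegral_subtype_comap (measurableSet_singleton _).compl fun x ↦ f ‖x‖,
        restrict_compl_singleton]
    _ = ∫⁻ x, f x.2 ∂μ.toSphere.prod (.volumeIoiPow (Module.finrank ℝ F - 1)) := by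
      simpa using μ.measurePreserving_homeomorphUnitSphereProd.lintegral_comp_emb
        (Homeomorph.measurableEmbedding _) (f ∘ Subtype.val ∘ Prod.snd)
    _ = μ.toSphere univ *
        ∫⁻ x : Ioi (0 : ℝ), f x ∂.volumeIoiPow (Module.finrank ℝ F - 1) := by
      rw [lintegral_prod _ (by fun_prop)]
      simp [mul_comm]
    _ = _ := by
      rw [Measure.volumeIoiPow, lintegral_withDensity_eq_lintegral_mul _ (by fun_prop)
        (by fun_prop)]
      simp only [Pi.mul_apply]
      rw [lintegral_subtype_comap measurableSet_Ioi
        fun a ↦ ENNReal.ofReal (a ^ (Module.finrank ℝ F - 1)) * f a]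

/-- The integral of a function of the first coordinate and the norm. -/
theorem lintegral_fun_apply_zero_norm_sq (m : ℕ) (hm : m ≠ 0) {G : ℝ → ℝ → ℝ≥0∞}
    (hG : Measurable fun p : ℝ × ℝ ↦ G p.1 p.2) :
    ∫⁻ z : EuclideanSpace ℝ (Fin (m + 1)), G (z 0) (‖z‖ ^ 2) =
      (volume : Measure (EuclideanSpace ℝ (Fin m))).toSphere univ *
        ∫⁻ ρ in Ioi (0 : ℝ), ENNReal.ofReal (ρ ^ (m - 1)) * ∫⁻ a, G a (a ^ 2 + ρ ^ 2) := by
  have : Nonempty (Fin m) := Fin.pos_iff_nonempty.1 (Nat.pos_of_ne_zero hm)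
  have hG' : Measurable fun p : ℝ × ℝ ↦ G p.2 (p.2 ^ 2 + p.1 ^ 2) := by
    exact hG.comp (f := fun p : ℝ × ℝ ↦ (p.2, p.2 ^ 2 + p.1 ^ 2)) (by fun_prop)
  calc
    _ = ∫⁻ z : Fin (m + 1) → ℝ, G (z 0) (∑ i, z i ^ 2) := by
      rw [← (PiLp.volume_preserving_ofLp (Fin (m + 1))).lintegral_comp_emb
        (MeasurableEquiv.toLp 2 _).symm.measurableEmbedding]
      simp [EuclideanSpace.norm_sq_eq]
    _ = ∫⁻ p : ℝ × (Fin m → ℝ), G p.1 (p.1 ^ 2 + ∑ i, p.2 i ^ 2) := by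
      rw [← (volume_preserving_piFinSuccAbove (fun _ : Fin (m + 1) ↦ ℝ) 0).lintegral_comp_emb
        (MeasurableEquiv.measurableEmbedding _)]
      simp [Fin.sum_univ_succ, MeasurableEquiv.piFinSuccAbove, Fin.tail]
    _ = ∫⁻ w : Fin m → ℝ, ∫⁻ a, G a (a ^ 2 + ∑ i, w i ^ 2) := by
      rw [Measure.volume_eq_prod, lintegral_prod_symm]
      exact (hG.comp (f := fun p : ℝ × (Fin m → ℝ) ↦ (p.1, p.1 ^ 2 + ∑ i, p.2 i ^ 2))
        (by fun_prop)).aemeasurable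
    _ = ∫⁻ w : EuclideanSpace ℝ (Fin m), ∫⁻ a, G a (a ^ 2 + ‖w‖ ^ 2) := by
      rw [← (PiLp.volume_preserving_ofLp (Fin m)).lintegral_comp_emb
        (MeasurableEquiv.toLp 2 _).symm.measurableEmbedding]
      simp [EuclideanSpace.norm_sq_eq]
    _ = _ := by
      rw [lintegral_fun_norm_addHaar volume
        (f := fun ρ ↦ ∫⁻ a, G a (a ^ 2 + ρ ^ 2)) hG'.lintegral_prod_right]
      simp

theorem lintegral_Ioi_comp_mul_left {f : ℝ → ℝ≥0∞} (k : ℝ) {ρ : ℝ} (hρ : 0 < ρ) :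
    ∫⁻ a in Ioi (k * ρ), f a = ∫⁻ s in Ioi k, ENNReal.ofReal ρ * f (ρ * s) := by
  have := lintegral_image_eq_lintegral_abs_deriv_mul (s := Ioi k) (f := fun s ↦ ρ * s)
    (f' := fun _ ↦ ρ) measurableSet_Ioi
    (fun x _ ↦ by simpa using ((hasDerivAt_id x).const_mul ρ).hasDerivWithinAt)
    (mul_right_injective₀ hρ.ne').injOn f
  rw [image_mul_left_Ioi hρ, abs_of_pos hρ] at this
  rw [mul_comm k, this]

theorem lintegral_gaussian_sector (m : ℕ) (hm : m ≠ 0) (k : ℝ) :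
    ∫⁻ ρ in Ioi (0 : ℝ), ENNReal.ofReal (ρ ^ (m - 1)) *
        ∫⁻ a in Ioi (k * ρ), ENNReal.ofReal (Real.exp (-(a ^ 2 + ρ ^ 2))) =
      ENNReal.ofReal (1 / 2 * Real.Gamma ((m + 1) / 2)) *
        ∫⁻ s in Ioi k, ENNReal.ofReal ((1 + s ^ 2) ^ (-((m : ℝ) + 1) / 2)) := by
  calc
    _ = ∫⁻ ρ in Ioi (0 : ℝ), ∫⁻ s in Ioi k,
        ENNReal.ofReal (ρ ^ (m : ℝ) * Real.exp (-(1 + s ^ 2) * ρ ^ (2 : ℝ))) := by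
      refine setLIntegral_congr_fun measurableSet_Ioi fun ρ hρ ↦ ?_
      rw [mem_Ioi] at hρ
      rw [lintegral_Ioi_comp_mul_left k hρ, ← lintegral_const_mul _ (by fun_prop)]
      refine lintegral_congr fun s ↦ ?_
      rw [← ENNReal.ofReal_mul hρ.le, ← ENNReal.ofReal_mul (by positivity), ← mul_assoc,
        pow_sub_one_mul hm, Real.rpow_natCast, Real.rpow_two]
      ring_nf
    _ = ∫⁻ s in Ioi k, ∫⁻ ρ in Ioi (0 : ℝ),
        ENNReal.ofReal (ρ ^ (m : ℝ) * Real.exp (-(1 + s ^ 2) * ρ ^ (2 : ℝ))) := by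
      apply lintegral_lintegral_swap
      fun_prop
    _ = _ := by
      rw [← lintegral_const_mul _ (by fun_prop)]
      refine lintegral_congr fun s ↦ ?_
      have hm' : (-1 : ℝ) < m := by linarith [m.cast_nonneg (α := ℝ)]
      rw [← ofReal_integral_eq_lintegral_ofReal
        (integrableOn_rpow_mul_exp_neg_mul_rpow hm' two_pos (by positivity)),
        integral_rpow_mul_exp_neg_mul_rpow two_pos hm' (by positivity), ← ENNReal.ofReal_mul]
      · ring_nf
      · have : 0 < Real.Gamma (((m : ℝ) + 1) / 2) := Real.Gamma_pos_of_pos (by positivity)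
        positivity
      · filter_upwards [ae_restrict_mem measurableSet_Ioi] with x hx
        rw [mem_Ioi] at hx
        positivity

theorem lintegral_one_add_sq_rpow_eq_incBeta (m : ℕ) (hm : m ≠ 0) {k : ℝ} (hk : 0 ≤ k) :
    ∫⁻ s in Ioi k, ENNReal.ofReal ((1 + s ^ 2) ^ (-((m : ℝ) + 1) / 2)) =
      ENNReal.ofReal (1 / 2 * incBeta (1 / (1 + k ^ 2)) (m / 2) (1 / 2)) := by
  have hfin : ∫⁻ s in Ioi k, ENNReal.ofReal ((1 + s ^ 2) ^ (-((m : ℝ) + 1) / 2)) ≠ ∞ := by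
    refine ((setLIntegral_le_lintegral _ _).trans_lt ?_).ne
    refine lt_of_le_of_lt (lintegral_mono fun s ↦ ?_)
      (integrable_inv_one_add_sq.lintegral_lt_top)
    refine ENNReal.ofReal_le_ofReal ?_
    rw [← Real.rpow_neg_one]
    refine Real.rpow_le_rpow_of_exponent_le (by nlinarith [sq_nonneg s]) ?_
    have : (1 : ℝ) ≤ m := by exact_mod_cast Nat.one_le_iff_ne_zero.2 hm
    linarith
  have himage : (fun s : ℝ ↦ 1 / (1 + s ^ 2)) '' Ioi k = Ioo 0 (1 / (1 + k ^ 2)) := by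
    ext u
    simp only [mem_image, mem_Ioi, mem_Ioo]
    constructor
    · rintro ⟨s, hs, rfl⟩
      exact ⟨by positivity, by gcongr⟩
    · rintro ⟨h0, h1⟩
      have h2 : 1 + k ^ 2 < 1 / u := by rwa [lt_one_div (by positivity) h0]
      have h3 : 0 ≤ 1 / u - 1 := by nlinarith [sq_nonneg k]
      refine ⟨√(1 / u - 1), Real.lt_sqrt_of_sq_lt (by linarith), ?_⟩
      rw [Real.sq_sqrt h3]
      simp
  have hchange : ∫⁻ u in Ioo 0 (1 / (1 + k ^ 2)),
      ENNReal.ofReal (u ^ ((m : ℝ) / 2 - 1) * (1 - u) ^ ((1 : ℝ) / 2 - 1)) =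
      2 * ∫⁻ s in Ioi k, ENNReal.ofReal ((1 + s ^ 2) ^ (-((m : ℝ) + 1) / 2)) := by
    rw [← himage, lintegral_image_eq_lintegral_abs_deriv_mul measurableSet_Ioi
      (f' := fun s ↦ -(2 * s) / (1 + s ^ 2) ^ 2), ← lintegral_const_mul _ (by fun_prop)]
    · refine setLIntegral_congr_fun measurableSet_Ioi fun s hs ↦ ?_
      have hs : 0 < s := hk.trans_lt hs
      have hq : 0 < 1 + s ^ 2 := by positivity
      rw [← ENNReal.ofReal_mul (abs_nonneg _), ← ENNReal.ofReal_ofNat 2,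
        ← ENNReal.ofReal_mul zero_le_two]
      congr 1
      have h1 : 1 - 1 / (1 + s ^ 2) = s ^ 2 / (1 + s ^ 2) := by field_simp; ring
      have h2 : (s ^ 2) ^ ((1 : ℝ) / 2 - 1) = s⁻¹ := by
        rw [← Real.rpow_natCast, ← Real.rpow_mul hs.le, ← Real.rpow_neg_one]
        norm_num
      rw [h1, one_div (1 + s ^ 2), Real.inv_rpow hq.le, Real.div_rpow (by positivity) hq.le, h2,
        neg_div, abs_neg, abs_of_pos (by positivity), ← Real.rpow_neg hq.le, div_eq_mul_inv s⁻¹,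
        ← Real.rpow_neg hq.le, div_eq_mul_inv, ← Real.rpow_natCast (1 + s ^ 2) 2,
        ← Real.rpow_neg hq.le]
      have h3 : -((m : ℝ) + 1) / 2 = -((2 : ℕ) : ℝ) + (-((m : ℝ) / 2 - 1) + -(1 / 2 - 1)) := by
        push_cast; ring
      rw [h3, Real.rpow_add hq, Real.rpow_add hq]
      field_simp
    · intro s _
      have : HasDerivAt (fun s : ℝ ↦ 1 / (1 + s ^ 2)) (-(2 * s) / (1 + s ^ 2) ^ 2) s := by
        simpa [one_div] using ((hasDerivAt_pow 2 s).const_add 1).fun_inv (by positivity)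
      exact this.hasDerivWithinAt
    · intro s hs s' hs' h
      have hs : 0 < s := hk.trans_lt hs
      have hs' : 0 < s' := hk.trans_lt hs'
      simp only [one_div, inv_inj, add_right_inj] at h
      exact (pow_left_inj₀ hs.le hs'.le two_ne_zero).1 h
  have hval : incBeta (1 / (1 + k ^ 2)) (m / 2) (1 / 2) =
      (2 * ∫⁻ s in Ioi k, ENNReal.ofReal ((1 + s ^ 2) ^ (-((m : ℝ) + 1) / 2))).toReal := by
    rw [← hchange, incBeta, intervalIntegral.integral_of_le (by positivity),
      integral_Ioc_eq_integral_Ioo, integral_eq_lintegral_of_nonneg_ae]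
    · filter_upwards [ae_restrict_mem measurableSet_Ioo] with u hu
      have h1 : 1 / (1 + k ^ 2) ≤ 1 := by
        rw [div_le_one (by positivity)]; nlinarith [sq_nonneg k]
      have h2 : 0 ≤ 1 - u := by linarith [hu.2]
      have h3 := hu.1
      positivity
    · exact Measurable.aestronglyMeasurable (by fun_prop)
  rw [hval, ENNReal.toReal_mul, ENNReal.toReal_ofNat, ← mul_assoc,
    one_div_mul_cancel two_ne_zero, one_mul, ENNReal.ofReal_toReal hfin]

/-- The integral of a function of the norm and the inner product with a fixed unit vector. -/
theorem lintegral_fun_inner_norm_sq (m : ℕ) (hm : m ≠ 0) {G : ℝ → ℝ → ℝ≥0∞}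
    (hG : Measurable fun p : ℝ × ℝ ↦ G p.1 p.2) {x : EuclideanSpace ℝ (Fin (m + 1))}
    (hx : ‖x‖ = 1) :
    ∫⁻ z, G ⟪x, z⟫ (‖z‖ ^ 2) =
      (volume : Measure (EuclideanSpace ℝ (Fin m))).toSphere univ *
        ∫⁻ ρ in Ioi (0 : ℝ), ENNReal.ofReal (ρ ^ (m - 1)) * ∫⁻ a, G a (a ^ 2 + ρ ^ 2) := by
  rw [← lintegral_fun_apply_zero_norm_sq m hm hG]
  have hnorm : ‖x‖ = ‖EuclideanSpace.single (0 : Fin (m + 1)) (1 : ℝ)‖ := by simp [hx]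
  set R := (ℝ ∙ (x - EuclideanSpace.single (0 : Fin (m + 1)) (1 : ℝ)))ᗮ.reflection
  have hR : R x = EuclideanSpace.single 0 1 := Submodule.reflection_sub hnorm
  rw [← R.measurePreserving.lintegral_comp_emb R.toHomeomorph.measurableEmbedding]
  refine lintegral_congr fun z ↦ ?_
  rw [← R.inner_map_map, hR, R.norm_map, EuclideanSpace.inner_single_left,
    Submodule.reflection_reflection]
  simp

/-- The Gaussian measure of a rotationally symmetric sector, which may or may not contain its
boundary. -/
theorem setLIntegral_gaussian_sector (m : ℕ) (hm : m ≠ 0) {k : ℝ} (hk : 0 ≤ k)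
    {A : Set (ℝ × ℝ)} (hA : MeasurableSet A)
    (hA₁ : ∀ ρ > 0, ∀ a, k * ρ < a → (a, a ^ 2 + ρ ^ 2) ∈ A)
    (hA₂ : ∀ ρ > 0, ∀ a, (a, a ^ 2 + ρ ^ 2) ∈ A → k * ρ ≤ a)
    {x : EuclideanSpace ℝ (Fin (m + 1))} (hx : ‖x‖ = 1) :
    ∫⁻ z in {z | (⟪x, z⟫, ‖z‖ ^ 2) ∈ A}, ENNReal.ofReal (Real.exp (-‖z‖ ^ 2)) =
      (volume : Measure (EuclideanSpace ℝ (Fin m))).toSphere univ *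
        (ENNReal.ofReal (1 / 2 * Real.Gamma ((m + 1) / 2)) *
          ENNReal.ofReal (1 / 2 * incBeta (1 / (1 + k ^ 2)) (m / 2) (1 / 2))) := by
  have hmeas : MeasurableSet {z : EuclideanSpace ℝ (Fin (m + 1)) | (⟪x, z⟫, ‖z‖ ^ 2) ∈ A} :=
    hA.preimage (f := fun z : EuclideanSpace ℝ (Fin (m + 1)) ↦ (⟪x, z⟫, ‖z‖ ^ 2)) (by fun_prop)
  have := lintegral_fun_inner_norm_sq m hm
    (G := fun a q ↦ A.indicator (fun p ↦ ENNReal.ofReal (Real.exp (-p.2))) (a, q))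
    (Measurable.indicator (by fun_prop) hA) hx
  rw [← lintegral_one_add_sq_rpow_eq_incBeta m hm hk, ← lintegral_gaussian_sector m hm,
    ← lintegral_indicator hmeas]
  refine Eq.trans (lintegral_congr fun z ↦ ?_) (this.trans ?_)
  · simp [indicator]
  · congr 1
    refine setLIntegral_congr_fun measurableSet_Ioi fun ρ hρ ↦ ?_
    rw [← lintegral_indicator measurableSet_Ioi]
    congr 1
    refine lintegral_congr_ae ?_
    filter_upwards [Measure.ae_ne volume (k * ρ)] with a ha
    have : (a, a ^ 2 + ρ ^ 2) ∈ A ↔ k * ρ < a :=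
      ⟨fun h ↦ (hA₂ ρ hρ a h).lt_of_ne' ha, hA₁ ρ hρ a⟩
    simp [indicator, this]

theorem setLIntegral_gaussian_cap (m : ℕ) (hm : m ≠ 0) {t : ℝ} (ht₀ : 0 ≤ t) (ht₁ : t < 1)
    {x : EuclideanSpace ℝ (Fin (m + 1))} (hx : ‖x‖ = 1) :
    ∫⁻ z in {z | t * ‖z‖ ≤ ⟪x, z⟫}, ENNReal.ofReal (Real.exp (-‖z‖ ^ 2)) =
      (volume : Measure (EuclideanSpace ℝ (Fin m))).toSphere univ *
        (ENNReal.ofReal (1 / 2 * Real.Gamma ((m + 1) / 2)) *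
          ENNReal.ofReal (1 / 2 * incBeta (1 - t ^ 2) (m / 2) (1 / 2))) := by
  have hpos : 0 < 1 - t ^ 2 := by nlinarith
  have hk : 0 ≤ t / √(1 - t ^ 2) := by positivity
  have hk2 : (t / √(1 - t ^ 2)) ^ 2 = t ^ 2 / (1 - t ^ 2) := by
    rw [div_pow, Real.sq_sqrt hpos.le]
  have hk' : 1 / (1 + (t / √(1 - t ^ 2)) ^ 2) = 1 - t ^ 2 := by
    rw [hk2]; field_simp; ring
  have hiff (ρ a : ℝ) : t ^ 2 * (a ^ 2 + ρ ^ 2) ≤ a ^ 2 ↔ (t / √(1 - t ^ 2) * ρ) ^ 2 ≤ a ^ 2 := by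
    rw [mul_pow, hk2, div_mul_eq_mul_div, div_le_iff₀ hpos]
    constructor <;> intro h <;> linarith
  rw [← hk', ← setLIntegral_gaussian_sector m hm hk (A := {p | t * √p.2 ≤ p.1}) _ _ _ hx]
  · simp
  · exact measurableSet_le (by fun_prop) (by fun_prop)
  · intro ρ hρ a ha
    have ha0 : 0 ≤ a := le_trans (by positivity) ha.le
    have := (hiff ρ a).2 (by gcongr)
    rw [mem_ofPred_eq]
    refine le_of_sq_le_sq ?_ ha0
    rwa [mul_pow, Real.sq_sqrt (by positivity)]
  · intro ρ hρ a ha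
    rw [mem_ofPred_eq] at ha
    have ha0 : 0 ≤ a := le_trans (by positivity) ha
    refine le_of_sq_le_sq ((hiff ρ a).1 ?_) ha0
    rw [← Real.sq_sqrt (x := a ^ 2 + ρ ^ 2) (by positivity), ← mul_pow]
    gcongr

theorem setLIntegral_gaussian_open_half_space (m : ℕ) (hm : m ≠ 0)
    {x : EuclideanSpace ℝ (Fin (m + 1))} (hx : ‖x‖ = 1) :
    ∫⁻ z in {z | 0 < ⟪x, z⟫}, ENNReal.ofReal (Real.exp (-‖z‖ ^ 2)) =
      (volume : Measure (EuclideanSpace ℝ (Fin m))).toSphere univ *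
        (ENNReal.ofReal (1 / 2 * Real.Gamma ((m + 1) / 2)) *
          ENNReal.ofReal (1 / 2 * incBeta 1 (m / 2) (1 / 2))) := by
  have := setLIntegral_gaussian_sector m hm le_rfl (A := {p | 0 < p.1})
    (measurableSet_lt (by fun_prop) (by fun_prop)) (by simp)
    (fun ρ _ a h ↦ by simpa using le_of_lt h) hx
  simpa using this

theorem incBeta_nonneg {x y z : ℝ} (hx₀ : 0 ≤ x) (hx₁ : x ≤ 1) : 0 ≤ incBeta x y z :=
  intervalIntegral.integral_nonneg hx₀ fun u hu ↦
    mul_nonneg (Real.rpow_nonneg hu.1 _) (Real.rpow_nonneg (by linarith [hu.2]) _)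

/-- Finitely many spherical caps which cover the sphere are at least as many as the ratio of the
areas of the sphere and of a cap. -/
theorem two_mul_incBeta_le_card_mul (m : ℕ) (hm : m ≠ 0) {t : ℝ} (ht₀ : 0 ≤ t) (ht₁ : t < 1)
    {C : Finset (EuclideanSpace ℝ (Fin (m + 1)))} (hC : ∀ x ∈ C, ‖x‖ = 1)
    (hcover : ∀ z : EuclideanSpace ℝ (Fin (m + 1)), ‖z‖ = 1 → ∃ x ∈ C, t ≤ ⟪x, z⟫) :
    2 * incBeta 1 (m / 2) (1 / 2) ≤ C.card * incBeta (1 - t ^ 2) (m / 2) (1 / 2) := by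
  have : Nonempty (Fin m) := Fin.pos_iff_nonempty.1 (Nat.pos_of_ne_zero hm)
  set w : EuclideanSpace ℝ (Fin (m + 1)) → ℝ≥0∞ := fun z ↦ ENNReal.ofReal (Real.exp (-‖z‖ ^ 2))
    with hw
  set V := (volume : Measure (EuclideanSpace ℝ (Fin m))).toSphere univ
  set Γ := ENNReal.ofReal (1 / 2 * Real.Gamma (((m : ℝ) + 1) / 2))
  have hV₀ : V ≠ 0 := by
    simp [V, Measure.toSphere_apply_univ, hm, (measure_ball_pos volume _ one_pos).ne']
  have hV : V ≠ ∞ := measure_ne_top _ _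
  have hΓ₀ : Γ ≠ 0 := by
    have : 0 < Real.Gamma (((m : ℝ) + 1) / 2) := Real.Gamma_pos_of_pos (by positivity)
    exact (ENNReal.ofReal_pos.2 (by positivity)).ne'
  have hΓ : Γ ≠ ∞ := ENNReal.ofReal_ne_top
  have hβ₁ := incBeta_nonneg (x := 1) (y := m / 2) (z := 1 / 2) zero_le_one le_rfl
  have hβ := incBeta_nonneg (x := 1 - t ^ 2) (y := m / 2) (z := 1 / 2) (by nlinarith)
    (by nlinarith [sq_nonneg t])
  have hlower : 2 * (V * (Γ * ENNReal.ofReal (1 / 2 * incBeta 1 (m / 2) (1 / 2)))) ≤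
      ∫⁻ z, w z := by
    set e : EuclideanSpace ℝ (Fin (m + 1)) := EuclideanSpace.single 0 1
    have he : ‖e‖ = 1 := by simp [e]
    rw [two_mul]
    nth_rw 1 [← setLIntegral_gaussian_open_half_space m hm he]
    rw [← setLIntegral_gaussian_open_half_space m hm (x := -e) (by simpa using he),
      ← lintegral_union (measurableSet_lt (by fun_prop) (by fun_prop))]
    · exact setLIntegral_le_lintegral _ _
    · rw [Set.disjoint_left]
      intro z hz hz'
      simp only [mem_ofPred_eq, inner_neg_left] at hz hz'
      linarith
  have hupper : ∫⁻ z, w z ≤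
      C.card * (V * (Γ * ENNReal.ofReal (1 / 2 * incBeta (1 - t ^ 2) (m / 2) (1 / 2)))) := by
    have hunion : ⋃ x ∈ C, {z | t * ‖z‖ ≤ ⟪x, z⟫} = univ := by
      refine eq_univ_of_forall fun z ↦ ?_
      simp only [mem_iUnion, mem_ofPred_eq, exists_prop]
      rcases eq_or_ne z 0 with rfl | hz
      · obtain ⟨x, hx, -⟩ := hcover (EuclideanSpace.single 0 1) (by simp)
        exact ⟨x, hx, by simp⟩
      · have hz' : 0 < ‖z‖ := norm_pos_iff.2 hz
        obtain ⟨x, hx, h⟩ := hcover (‖z‖⁻¹ • z) (by simp [norm_smul, hz'.ne'])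
        refine ⟨x, hx, ?_⟩
        rwa [inner_smul_right, ← div_eq_inv_mul, le_div_iff₀ hz'] at h
    calc
      ∫⁻ z, w z = ∫⁻ z in ⋃ x ∈ C, {z | t * ‖z‖ ≤ ⟪x, z⟫}, w z := by
        rw [hunion, setLIntegral_univ]
      _ ≤ ∑ x ∈ C, ∫⁻ z in {z | t * ‖z‖ ≤ ⟪x, z⟫}, w z := by
        simp_rw [← withDensity_apply' (μ := volume) w]
        exact measure_biUnion_finset_le _ _
      _ = _ := by
        rw [Finset.sum_congr rfl fun x hx ↦ setLIntegral_gaussian_cap m hm ht₀ ht₁ (hC x hx)]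
        simp [V, Γ]
  have := hlower.trans hupper
  rw [mul_left_comm, mul_left_comm (C.card : ℝ≥0∞), ENNReal.mul_le_mul_iff_right hV₀ hV,
    mul_left_comm, mul_left_comm (C.card : ℝ≥0∞), ENNReal.mul_le_mul_iff_right hΓ₀ hΓ,
    ← ENNReal.ofReal_ofNat 2, ← ENNReal.ofReal_natCast, ← ENNReal.ofReal_mul (by positivity),
    ← ENNReal.ofReal_mul (by positivity), ENNReal.ofReal_le_ofReal_iff (by positivity)] at this
  linarith

/-- A maximal separated subset of the sphere is a spherical code whose caps cover the sphere. -/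
theorem exists_isSphericalCode_cover (n : ℕ) {t : ℝ} (ht : t < 1) :
    ∃ C : Finset (EuclideanSpace ℝ (Fin n)), IsSphericalCode n t C ∧
      ∀ z : EuclideanSpace ℝ (Fin n), ‖z‖ = 1 → ∃ x ∈ C, t ≤ ⟪x, z⟫ := by
  have hdist (x y : EuclideanSpace ℝ (Fin n)) (hx : ‖x‖ = 1) (hy : ‖y‖ = 1) :
      dist x y ^ 2 = 2 - 2 * ⟪x, y⟫ := by
    rw [dist_eq_norm, norm_sub_sq_real, hx, hy]; ring
  set ε : ℝ≥0 := Real.toNNReal √(2 - 2 * t) with hε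
  have hε₀ : 0 < ε := Real.toNNReal_pos.2 (Real.sqrt_pos.2 (by linarith))
  have hε2 : (ε : ℝ) ^ 2 = 2 - 2 * t := by
    rw [hε, Real.coe_toNNReal _ (Real.sqrt_nonneg _), Real.sq_sqrt (by linarith)]
  set S := sphere (0 : EuclideanSpace ℝ (Fin n)) 1
  have hpack : packingNumber ε S ≠ ⊤ := by
    obtain ⟨N, -, hN, hcov⟩ := exists_finite_isCover_of_isCompact (ε := ε / 2)
      (half_pos hε₀).ne' (isCompact_sphere (0 : EuclideanSpace ℝ (Fin n)) 1)
    have h := packingNumber_two_mul_le_externalCoveringNumber (ε / 2) S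
    rw [mul_div_cancel₀ _ two_ne_zero] at h
    exact (h.trans_lt ((iInf₂_le N hcov).trans_lt hN.encard_lt_top)).ne
  have hfin : (maximalSeparatedSet ε S).Finite := by
    rw [← Set.encard_ne_top_iff, encard_maximalSeparatedSet hpack]
    exact hpack
  have hnorm : ∀ x ∈ maximalSeparatedSet ε S, ‖x‖ = 1 := fun x hx ↦ by
    simpa [S] using maximalSeparatedSet_subset hx
  refine ⟨hfin.toFinset, ⟨by simpa using hnorm, ?_⟩, fun z hz ↦ ?_⟩
  · simp only [Finite.mem_toFinset]
    intro x hx y hy hxy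
    have h : ε < edist x y := isSeparated_maximalSeparatedSet hx hy hxy
    have h : (ε : ℝ) < dist x y := by
      rwa [edist_nndist, ENNReal.coe_lt_coe, ← NNReal.coe_lt_coe, coe_nndist] at h
    have h2 : (ε : ℝ) ^ 2 < dist x y ^ 2 := by gcongr
    rw [hε2, hdist x y (hnorm x hx) (hnorm y hy)] at h2
    linarith
  · obtain ⟨x, hx, h⟩ := isCover_maximalSeparatedSet hpack (show z ∈ S by simpa [S] using hz)
    refine ⟨x, by simpa using hx, ?_⟩
    have h : dist z x ≤ ε := by
      change edist z x ≤ ε at h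
      rwa [edist_nndist, ENNReal.coe_le_coe, ← NNReal.coe_le_coe, coe_nndist] at h
    have h2 : dist z x ^ 2 ≤ (ε : ℝ) ^ 2 := by gcongr
    rw [hε2, hdist z x hz (hnorm x hx), real_inner_comm] at h2
    linarith

/-- Theorem 3.2, first case (0 ≤ r ≤ π/4): lower bound for the kissing number
in spherical space, in terms of spherical codes. -/
theorem lower_bound_kappa_S_small (n : ℕ) (hn : 2 ≤ n) (r : ℝ)
    (hr0 : 0 ≤ r) (hr : r ≤ Real.pi / 4) :
    ∃ C : Finset (EuclideanSpace ℝ (Fin n)),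
      IsSphericalCode n (Real.cos (2 * r) / (1 + Real.cos (2 * r))) C ∧
      2 * incBeta 1 ((n - 1) / 2) (1 / 2) /
          incBeta ((1 / Real.cos r) ^ 2 - (1 / Real.cos r) ^ 4 / 4) ((n - 1) / 2) (1 / 2)
        ≤ (C.card : ℝ) := by
  obtain ⟨m, rfl⟩ : ∃ m, n = m + 1 := ⟨n - 1, by omega⟩
  have hcos : 0 < Real.cos r :=
    Real.cos_pos_of_mem_Ioo ⟨by linarith [Real.pi_pos], by linarith [Real.pi_pos]⟩
  have hcos2 : 0 ≤ Real.cos (2 * r) :=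
    Real.cos_nonneg_of_mem_Icc ⟨by linarith [Real.pi_pos], by linarith⟩
  set t := Real.cos (2 * r) / (1 + Real.cos (2 * r)) with ht
  have ht₀ : 0 ≤ t := by positivity
  have ht₁ : t < 1 := by rw [ht, div_lt_one (by positivity)]; linarith
  have harg : (1 / Real.cos r) ^ 2 - (1 / Real.cos r) ^ 4 / 4 = 1 - t ^ 2 := by
    rw [ht, Real.cos_two_mul, add_sub_cancel]
    field_simp
    ring
  obtain ⟨C, hC, hcover⟩ := exists_isSphericalCode_cover (m + 1) ht₁
  refine ⟨C, hC, ?_⟩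
  have hm : (((m + 1 : ℕ) : ℝ) - 1) / 2 = m / 2 := by push_cast; ring
  rw [harg, hm]
  exact div_le_of_le_mul₀ (incBeta_nonneg (by nlinarith) (by nlinarith [sq_nonneg t]))
    (Nat.cast_nonneg _) (two_mul_incBeta_le_card_mul m (by omega) ht₀ ht₁ hC.1 hcover)
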